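/- Every symmetric 4-digit (σ,k)-permutiple [a_0; a_1, a_2, a_3] is continuant-preserving, i.e., K_4(a_0, a_1, a_2, a_3) = K_4(a_{σ(0)}, a_{σ(1)}, a_{σ(2)}, a_{σ(3)}). -/

import Mathlib

/-- Value of the finite simple continued fraction `[x₀; x₁, …, xₙ]`. -/
def cfv : List ℚ → ℚ
  | [] => 0
  | [x] => x
  | x :: y :: t => x + 1 / cfv (y :: t)

/-- The continuant `K(x₀, …, xₙ)`: `K() = 1`, `K(x₀) = x₀`, and the usual
three-term recurrence. -/
def cont : List ℕ → ℕ
  | [] => 1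
  | [x] => x
  | x :: y :: t => x * cont (y :: t) + cont t

/-- The digit string of `a`, as a list of rationals. -/
def digitsQ {N : ℕ} (a : Fin N → ℕ) : List ℚ := (List.ofFn a).map (fun x => (x : ℚ))

/-- `[a₀; a₁, …, aₙ]` (canonical: positive digits, last digit ≥ 2) is a
`(σ,k)`-permutiple: it equals `k` times the continued fraction of the permuted digits. -/
def IsPermutiple {n : ℕ} (a : Fin (n+1) → ℕ) (σ : Equiv.Perm (Fin (n+1))) (k : ℕ) : Prop :=
  (∀ j, 0 < a j) ∧ 2 ≤ a (Fin.last n) ∧ 1 < k ∧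
    cfv (digitsQ a) = k * cfv (digitsQ (a ∘ σ))

/-- A `(σ,k)`-permutiple is continuant-preserving if
`K(a₀,…,aₙ) = K(a_{σ(0)},…,a_{σ(n)})`. -/
def ContinuantPreserving {n : ℕ} (a : Fin (n+1) → ℕ) (σ : Equiv.Perm (Fin (n+1))) : Prop :=
  cont (List.ofFn a) = cont (List.ofFn (a ∘ σ))

/-- A `(σ,k)`-permutiple is perfect if `a_j = k·a_{σ(j)}` for even `j` and
`a_{σ(j)} = k·a_j` for odd `j`. -/
def IsPerfect {n : ℕ} (a : Fin (n+1) → ℕ) (σ : Equiv.Perm (Fin (n+1))) (k : ℕ) : Prop :=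
  ∀ j : Fin (n+1), (Even (j : ℕ) → a j = k * a (σ j)) ∧ (Odd (j : ℕ) → a (σ j) = k * a j)

/-- A `(σ,k)`-permutiple is symmetric if `a_j·a_{n−j} = a_{σ(j)}·a_{σ(n−j)}` for all `j`. -/
def IsSymmetric {n : ℕ} (a : Fin (n+1) → ℕ) (σ : Equiv.Perm (Fin (n+1))) : Prop :=
  ∀ j : Fin (n+1), a j * a j.rev = a (σ j) * a (σ j.rev)

/-- A Landess permutiple: a continuant-preserving `(σ,k)`-permutiple with
`q_{n−1} = q'_{n−1}` and `p_{n−1} = k·p'_{n−1}`. -/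
def IsLandess {n : ℕ} (a : Fin (n+1) → ℕ) (σ : Equiv.Perm (Fin (n+1))) (k : ℕ) : Prop :=
  IsPermutiple a σ k ∧ ContinuantPreserving a σ ∧
    cont ((List.ofFn a).tail.dropLast) = cont ((List.ofFn (a ∘ σ)).tail.dropLast) ∧
    cont ((List.ofFn a).dropLast) = k * cont ((List.ofFn (a ∘ σ)).dropLast)

theorem cfv_four (a b c d : ℕ) (hb : 0 < b) (hc : 0 < c) (hd : 0 < d) :
    cfv [(a : ℚ), b, c, d] = ((cont [a, b, c, d] : ℕ) : ℚ) / ((cont [b, c, d] : ℕ) : ℚ) := by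
  have hb' : (0 : ℚ) < b := by exact_mod_cast hb
  have hc' : (0 : ℚ) < c := by exact_mod_cast hc
  have hd' : (0 : ℚ) < d := by exact_mod_cast hd
  have h1 : (c : ℚ) + 1 / d = (c * d + 1) / d := by field_simp
  have h2 : (b : ℚ) + 1 / ((c * d + 1) / d) = (b * (c * d + 1) + d) / (c * d + 1) := by
    field_simp
  simp only [cfv, cont, h1, h2]
  push_cast
  field_simp

theorem cont_four_coprime (a b c d : ℕ) : Nat.Coprime (cont [a, b, c, d]) (cont [b, c, d]) := by
  simp [cont]

theorem cont_four_eq (a b c d w x y z k : ℕ) (ha : 0 < a) (hb : 0 < b) (hc : 0 < c) (hd : 0 < d)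
    (hx : 0 < x) (hy : 0 < y) (hz : 0 < z)
    (h1 : a * d = w * z) (h2 : b * c = x * y)
    (h : cfv [(a : ℚ), b, c, d] = k * cfv [(w : ℚ), x, y, z]) :
    cont [a, b, c, d] = cont [w, x, y, z] := by
  rw [cfv_four a b c d hb hc hd, cfv_four w x y z hx hy hz] at h
  have hq : 0 < cont [b, c, d] := by simp only [cont]; positivity
  have hq' : 0 < cont [x, y, z] := by simp only [cont]; positivity
  have hp : 0 < cont [a, b, c, d] := by simp only [cont]; positivity
  have hlt : cont [a, b, c, d] < 2 * cont [w, x, y, z] := by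
    have hm : (a * d) * (b * c) = (w * z) * (x * y) := by rw [h1, h2]
    obtain ⟨u, hu⟩ : ∃ u, a * b = u + 1 := ⟨a * b - 1, by have := Nat.mul_pos ha hb; omega⟩
    obtain ⟨v, hv⟩ : ∃ v, c * d = v + 1 := ⟨c * d - 1, by have := Nat.mul_pos hc hd; omega⟩
    have hm2 : (a * d) * (b * c) = (u + 1) * (v + 1) := by rw [← hu, ← hv]; ring
    simp only [cont]
    nlinarith [Nat.zero_le (u * v), Nat.zero_le (w * x), Nat.zero_le (y * z), Nat.zero_le (w * z)]
  have hcop' := cont_four_coprime w x y z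
  generalize cont [a, b, c, d] = p at *
  generalize cont [w, x, y, z] = p' at *
  generalize cont [b, c, d] = q at *
  generalize cont [x, y, z] = q' at *
  have hq0 : (q : ℚ) ≠ 0 := by positivity
  have hq0' : (q' : ℚ) ≠ 0 := by positivity
  field_simp at h
  have hN : p * q' = p' * (q * k) := by
    have : (p : ℚ) * q' = p' * (q * k) := by linarith
    exact_mod_cast this
  obtain ⟨m, hm⟩ : p' ∣ p := hcop'.dvd_of_dvd_mul_right ⟨_, hN⟩
  have : m = 1 := by
    have h3 : m < 2 := by
      by_contra hcon
      nlinarith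
    have h4 : m ≠ 0 := by rintro rfl; omega
    omega
  subst this
  omega

/-- Every symmetric 4-digit `(σ,k)`-permutiple is continuant-preserving:
`K₄(a₀,a₁,a₂,a₃) = K₄(a_{σ(0)},a_{σ(1)},a_{σ(2)},a_{σ(3)})`. -/
theorem stmt14 (a : Fin 4 → ℕ) (σ : Equiv.Perm (Fin 4)) (k : ℕ)
    (h : IsPermutiple (n := 3) a σ k) (hs : IsSymmetric (n := 3) a σ) :
    cont (List.ofFn a) = cont (List.ofFn (a ∘ σ)) := by
  obtain ⟨hpos, -, -, h⟩ := h
  have e1 : a 0 * a 3 = a (σ 0) * a (σ 3) := hs 0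
  have e2 : a 1 * a 2 = a (σ 1) * a (σ 2) := hs 1
  simp only [digitsQ, List.ofFn_succ, List.ofFn_zero, List.map_cons, List.map_nil] at h
  simp only [List.ofFn_succ, List.ofFn_zero]
  exact cont_four_eq _ _ _ _ _ _ _ _ k (hpos _) (hpos _) (hpos _) (hpos _) (hpos _) (hpos _)
    (hpos _) e1 e2 h
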